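/- For every a ∈ [1,3], the set of optimizers 𝒞_τ^(a) of the variational problem 'minimize I_τ(∂E)/Leb(E) over sets of finite perimeter E ⊆ [-1,1]² with Leb(E) ≤ a' is non-empty; that is, there exists E ∈ 𝒞 with Leb(E) ≤ a and I_τ(∂E)/Leb(E) = ψ_τ^(a). -/

import Mathlib

open MeasureTheory Set Filter ENNReal

noncomputable section

/-- The closed square `[-1,1]²` in `ℝ × ℝ`. -/
def Isq : Set (ℝ × ℝ) := Set.Icc (-1, -1) (1, 1)

/-- The open square `(-1,1)²` in `ℝ × ℝ`. -/
def Osq : Set (ℝ × ℝ) := Set.Ioo (-1, -1) (1, 1)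

/-- `τ` is a norm on `ℝ²`. -/
def IsNorm2 (τ : ℝ × ℝ → ℝ) : Prop :=
  (∀ x, τ x = 0 ↔ x = 0) ∧ (∀ (c : ℝ) (x), τ (c • x) = |c| * τ x) ∧
    ∀ x y, τ (x + y) ≤ τ x + τ y

/-- The Euclidean norm on `ℝ × ℝ`. -/
def eNorm2 (v : ℝ × ℝ) : ℝ := Real.sqrt (v.1 ^ 2 + v.2 ^ 2)

/-- The dual norm `τ*` of a norm `τ` on `ℝ²`. -/
def dualNorm (τ : ℝ × ℝ → ℝ) (w : ℝ × ℝ) : ℝ :=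
  sSup {x | ∃ v : ℝ × ℝ, τ v ≤ 1 ∧ x = v.1 * w.1 + v.2 * w.2}

/-- The divergence of a vector field on `ℝ²`. -/
def div2 (f : ℝ × ℝ → ℝ × ℝ) (x : ℝ × ℝ) : ℝ :=
  (fderiv ℝ f x (1, 0)).1 + (fderiv ℝ f x (0, 1)).2

/-- The perimeter `per(∂E)` of a set `E ⊆ ℝ²`, as the supremum of `∫_E div f`
over smooth compactly supported vector fields with `|f|₂ ≤ 1`. -/
def per (E : Set (ℝ × ℝ)) : ℝ≥0∞ :=
  ⨆ f ∈ {f : ℝ × ℝ → ℝ × ℝ |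
      ContDiff ℝ (⊤ : ℕ∞) f ∧ HasCompactSupport f ∧ ∀ x, eNorm2 (f x) ≤ 1},
    ENNReal.ofReal (∫ x in E, div2 f x)

/-- The restricted surface energy `I_τ(∂E)`: the supremum of `∫_E div f` over smooth
vector fields compactly supported in the open square with `τ*(f) ≤ 1`. -/
def surfE (τ : ℝ × ℝ → ℝ) (E : Set (ℝ × ℝ)) : ℝ≥0∞ :=
  ⨆ f ∈ {f : ℝ × ℝ → ℝ × ℝ |
      ContDiff ℝ (⊤ : ℕ∞) f ∧ HasCompactSupport f ∧ tsupport f ⊆ Osq ∧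
        ∀ x, dualNorm τ (f x) ≤ 1},
    ENNReal.ofReal (∫ x in E, div2 f x)

/-- `E ∈ 𝒞`: `E` is a subset of `[-1,1]²` of finite perimeter. -/
def MemC (E : Set (ℝ × ℝ)) : Prop := E ⊆ Isq ∧ per E ≠ ⊤

open Classical in
/-- The conductance `I_τ(∂E)/Leb(E)` of `E`, with the convention `0/0 = ∞`. -/
def conduct (τ : ℝ × ℝ → ℝ) (E : Set (ℝ × ℝ)) : ℝ≥0∞ :=
  if volume E = 0 then ⊤ else surfE τ E / volume E

/-- The optimal conductance `ψ_τ^(a)` over sets of finite perimeter in the square. -/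
def psi (τ : ℝ × ℝ → ℝ) (a : ℝ) : ℝ≥0∞ :=
  ⨅ E ∈ {E : Set (ℝ × ℝ) | MemC E ∧ volume E ≤ ENNReal.ofReal a}, conduct τ E

/-- The set of optimizers `𝒞_τ^(a)`. -/
def Copt (τ : ℝ × ℝ → ℝ) (a : ℝ) : Set (Set (ℝ × ℝ)) :=
  {E | MemC E ∧ volume E ≤ ENNReal.ofReal a ∧ conduct τ E = psi τ a}

/-- A set of finite perimeter is decomposable if it can be split into two parts of positive
measure whose perimeters add up to the perimeter of the whole. -/
def Decomposable (E : Set (ℝ × ℝ)) : Prop :=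
  ∃ A B : Set (ℝ × ℝ), E = A ∪ B ∧ Disjoint A B ∧ 0 < volume A ∧ 0 < volume B ∧
    per E = per A + per B

/-- The length of the curve `γ` measured with the gauge `β`: the supremum, over partitions
`0 = t₀ ≤ t₁ ≤ ⋯ ≤ t_n = 1`, of `∑ β(γ(t_j) - γ(t_{j-1}))`. -/
def varLength (β : ℝ × ℝ → ℝ) (γ : ℝ → ℝ × ℝ) : ℝ≥0∞ :=
  ⨆ (n : ℕ) (t : Fin (n + 1) → ℝ)
    (_ : Monotone t ∧ t 0 = 0 ∧ t (Fin.last n) = 1),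
    ENNReal.ofReal (∑ i : Fin n, β (γ (t i.succ) - γ (t i.castSucc)))

/-- `C` is a rectifiable Jordan curve: the image of a continuous injective map of the unit
circle (equivalently, a continuous `1`-periodic map injective on `[0,1)`) of finite length. -/
def IsRectJordanCurve (C : Set (ℝ × ℝ)) : Prop :=
  ∃ γ : ℝ → ℝ × ℝ, Continuous γ ∧ (∀ t, γ (t + 1) = γ t) ∧
    Set.InjOn γ (Set.Ico 0 1) ∧ C = γ '' Set.Icc 0 1 ∧ varLength eNorm2 γ ≠ ⊤

/-- The hull of a curve `C`: the union of `C` with all bounded connected components of its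
complement. -/
def hullSet (C : Set (ℝ × ℝ)) : Set (ℝ × ℝ) :=
  C ∪ {x | x ∉ C ∧ Bornology.IsBounded (connectedComponentIn Cᶜ x)}

/-- `R ∈ ℛ`: `R` is a compact subset of the square with nonempty interior whose boundary is
a finite union of rectifiable Jordan curves, any two of which have `ℋ¹`-null intersection. -/
def MemR (R : Set (ℝ × ℝ)) : Prop :=
  IsCompact R ∧ R ⊆ Isq ∧ (interior R).Nonempty ∧
    ∃ F : Finset (Set (ℝ × ℝ)),
      (∀ C ∈ F, IsRectJordanCurve C) ∧ frontier R = ⋃ C ∈ F, C ∧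
        ∀ C ∈ F, ∀ C' ∈ F, C ≠ C' →
          (MeasureTheory.Measure.hausdorffMeasure 1 : Measure (ℝ × ℝ)) (C ∩ C') = 0

/-- The optimal conductance `φ_τ^(a)` over the class `ℛ`. -/
def phiR (τ : ℝ × ℝ → ℝ) (a : ℝ) : ℝ≥0∞ :=
  ⨅ R ∈ {R : Set (ℝ × ℝ) | MemR R ∧ volume R ≤ ENNReal.ofReal a}, conduct τ R

/-- The set of optimizers `ℛ_τ^(a)`. -/
def Ropt (τ : ℝ × ℝ → ℝ) (a : ℝ) : Set (Set (ℝ × ℝ)) :=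
  {R | MemR R ∧ volume R ≤ ENNReal.ofReal a ∧ conduct τ R = phiR τ a}

/-- `L¹` convergence of sets: `Leb(E_k Δ E₀) → 0`. -/
def TendstoL1 (E : ℕ → Set (ℝ × ℝ)) (E₀ : Set (ℝ × ℝ)) : Prop :=
  Tendsto (fun k => volume (symmDiff (E k) E₀)) atTop (nhds 0)

/-- `ρ` is a (piecewise-linear) polygonal curve on `[0,1]`. -/
def IsPolygonal (ρ : ℝ → ℝ × ℝ) : Prop :=
  ∃ (n : ℕ) (s : Fin (n + 1) → ℝ), Monotone s ∧ s 0 = 0 ∧ s (Fin.last n) = 1 ∧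
    ∀ i : Fin n, ∀ t ∈ Set.Icc (s i.castSucc) (s i.succ),
      ρ t = ρ (s i.castSucc) +
        ((t - s i.castSucc) / (s i.succ - s i.castSucc)) • (ρ (s i.succ) - ρ (s i.castSucc))

end


lemma dual_bound (τ : ℝ × ℝ → ℝ) (hτ : IsNorm2 τ) :
    ∃ C : ℝ, 0 < C ∧ ∀ w, dualNorm τ w ≤ C * ‖w‖ := by
  obtain ⟨h0, hs, ht⟩ := hτ
  have hneg : ∀ x, τ (-x) = τ x := fun x => by
    have := hs (-1) x
    simpa using this
  have hnn : ∀ x, 0 ≤ τ x := fun x => by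
    have := ht x (-x)
    rw [hneg, add_neg_cancel, (h0 0).2 rfl] at this
    linarith
  have hb : ∀ x, τ x ≤ (τ (1, 0) + τ (0, 1)) * ‖x‖ := fun x => by
    have h1 : x = x.1 • ((1, 0) : ℝ × ℝ) + x.2 • ((0, 1) : ℝ × ℝ) := by
      ext <;> simp
    have h2 := ht (x.1 • ((1, 0) : ℝ × ℝ)) (x.2 • ((0, 1) : ℝ × ℝ))
    rw [← h1, hs, hs] at h2
    have h3 : |x.1| ≤ ‖x‖ := norm_fst_le x
    have h4 : |x.2| ≤ ‖x‖ := norm_snd_le x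
    nlinarith [hnn (1, 0), hnn (0, 1)]
  have hc : Continuous τ := by
    have hK := hnn (1, 0)
    have hK' := hnn (0, 1)
    refine (LipschitzWith.of_dist_le_mul (K := ⟨τ (1, 0) + τ (0, 1), by positivity⟩) ?_).continuous
    intro x y
    rw [Real.dist_eq, dist_eq_norm]
    have h1 := ht (x - y) y
    have h2 := ht (y - x) x
    rw [sub_add_cancel] at h1 h2
    have h3 : τ (y - x) = τ (x - y) := by rw [← hneg]; congr 1; abel
    have h4 := hb (x - y)
    rw [abs_le]
    change -((τ (1, 0) + τ (0, 1)) * ‖x - y‖) ≤ _ ∧ _ ≤ (τ (1, 0) + τ (0, 1)) * ‖x - y‖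
    constructor <;> linarith
  have hcomp : IsCompact (Metric.sphere (0 : ℝ × ℝ) 1) := isCompact_sphere 0 1
  obtain ⟨z, hz, hmin⟩ := hcomp.exists_isMinOn ⟨(1, 0), by simp⟩ hc.continuousOn
  have hz0 : 0 < τ z := by
    refine lt_of_le_of_ne (hnn z) fun h => ?_
    have := (h0 z).1 h.symm
    rw [this] at hz
    simp at hz
  have hlow : ∀ x, τ z * ‖x‖ ≤ τ x := fun x => by
    by_cases hx : x = 0
    · subst hx; simp [hnn]
    have hxn : 0 < ‖x‖ := norm_pos_iff.2 hx
    have h1 : τ z ≤ τ (‖x‖⁻¹ • x) := hmin (by simp [norm_smul, hx])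
    rw [hs, abs_of_pos (inv_pos.2 hxn)] at h1
    calc τ z * ‖x‖ ≤ (‖x‖⁻¹ * τ x) * ‖x‖ := by gcongr
      _ = τ x := by field_simp
  refine ⟨2 / τ z, by positivity, fun w => ?_⟩
  refine csSup_le ⟨0, 0, by simp [(h0 0).2 rfl], by simp⟩ ?_
  rintro _ ⟨v, hv, rfl⟩
  have h1 : ‖v‖ ≤ 1 / τ z := by
    rw [le_div_iff₀ hz0, mul_comm]; exact (hlow v).trans hv
  have h2 : v.1 * w.1 ≤ ‖v‖ * ‖w‖ := by
    calc v.1 * w.1 ≤ |v.1 * w.1| := le_abs_self _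
      _ = |v.1| * |w.1| := abs_mul _ _
      _ ≤ _ := mul_le_mul (norm_fst_le v) (norm_fst_le w) (abs_nonneg _) (norm_nonneg _)
  have h3 : v.2 * w.2 ≤ ‖v‖ * ‖w‖ := by
    calc v.2 * w.2 ≤ |v.2 * w.2| := le_abs_self _
      _ = |v.2| * |w.2| := abs_mul _ _
      _ ≤ _ := mul_le_mul (norm_snd_le v) (norm_snd_le w) (abs_nonneg _) (norm_nonneg _)
  have h4 : ‖v‖ * ‖w‖ ≤ 1 / τ z * ‖w‖ := by gcongr
  calc _ ≤ 2 * (1 / τ z * ‖w‖) := by linarith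
    _ = _ := by ring

/-- The genuine open square. -/
def Oq : Set (ℝ × ℝ) := Set.Ioo (-1 : ℝ) 1 ×ˢ Set.Ioo (-1 : ℝ) 1

lemma isOpen_Oq : IsOpen Oq := isOpen_Ioo.prod isOpen_Ioo

lemma convex_Oq : Convex ℝ Oq := (convex_Ioo _ _).prod (convex_Ioo _ _)

lemma Oq_subset_Osq : Oq ⊆ Osq := by
  rintro ⟨x, y⟩ ⟨⟨h1, h2⟩, ⟨h3, h4⟩⟩
  exact ⟨Prod.mk_lt_mk.2 (Or.inl ⟨h1, h3.le⟩), Prod.mk_lt_mk.2 (Or.inl ⟨h2, h4.le⟩)⟩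

lemma Isq_eq : Isq = Set.Icc (-1 : ℝ) 1 ×ˢ Set.Icc (-1 : ℝ) 1 := by
  rw [Isq, Set.Icc_prod_Icc]

lemma Oq_subset_Isq : Oq ⊆ Isq := by
  rw [Isq_eq]
  exact Set.prod_mono Set.Ioo_subset_Icc_self Set.Ioo_subset_Icc_self

lemma volume_Oq : volume Oq = 4 := by
  rw [Oq, Measure.volume_eq_prod, Measure.prod_prod, Real.volume_Ioo, ← ENNReal.ofReal_mul (by norm_num)]
  norm_num

lemma Oq_ae_eq : (Oq : Set (ℝ × ℝ)) =ᵐ[volume] Isq := by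
  rw [Isq_eq, Oq, Measure.volume_eq_prod]
  exact Measure.set_prod_ae_eq Ioo_ae_eq_Icc Ioo_ae_eq_Icc

/-- Bound on the distributional derivative inside the open square. -/
def HP (E : Set (ℝ × ℝ)) (P : ℝ) : Prop :=
  ∀ (B : ℝ) (f : ℝ × ℝ → ℝ × ℝ), 0 ≤ B → ContDiff ℝ (⊤ : ℕ∞) f → HasCompactSupport f →
    tsupport f ⊆ Oq → (∀ x, ‖f x‖ ≤ B) → ∫ x in E, div2 f x ≤ B * P

lemma div2_smul (c : ℝ) (f : ℝ × ℝ → ℝ × ℝ) (hf : ContDiff ℝ (⊤ : ℕ∞) f) (x : ℝ × ℝ) :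
    div2 (fun y => c • f y) x = c * div2 f x := by
  have hd : DifferentiableAt ℝ f x := (hf.differentiable (by simp)) x
  have : fderiv ℝ (fun y => c • f y) x = c • fderiv ℝ f x := fderiv_const_smul hd c
  simp only [div2, this]
  simp
  ring

lemma HP_of_surfE (τ : ℝ × ℝ → ℝ) {C : ℝ} (hC : 0 < C) (hd : ∀ w, dualNorm τ w ≤ C * ‖w‖)
    (E : Set (ℝ × ℝ)) (hE : surfE τ E ≠ ⊤) : HP E (C * (surfE τ E).toReal) := by
  intro B f hB hf hfc hfs hfB
  rcases hB.eq_or_lt with rfl | hB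
  · have : f = fun _ => 0 := by
      ext1 x
      simpa using hfB x
    subst this
    simp [div2]
  have hCB : 0 < C * B := by positivity
  set g : ℝ × ℝ → ℝ × ℝ := fun y => (C * B)⁻¹ • f y with hg
  have hgt : tsupport g ⊆ tsupport f := by
    apply closure_mono
    intro x hx hfx
    apply hx
    simp [hg, hfx]
  have hmem : g ∈ {f : ℝ × ℝ → ℝ × ℝ |
      ContDiff ℝ (⊤ : ℕ∞) f ∧ HasCompactSupport f ∧ tsupport f ⊆ Osq ∧
        ∀ x, dualNorm τ (f x) ≤ 1} := by
    refine ⟨hf.const_smul _, hfc.of_isClosed_subset (isClosed_tsupport _) hgt,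
      hgt.trans (hfs.trans Oq_subset_Osq), fun x => (hd _).trans ?_⟩
    rw [hg, norm_smul, Real.norm_of_nonneg (by positivity)]
    have := hfB x
    calc C * ((C * B)⁻¹ * ‖f x‖) ≤ C * ((C * B)⁻¹ * B) := by gcongr
      _ = 1 := by field_simp
  have h1 : ENNReal.ofReal (∫ x in E, div2 g x) ≤ surfE τ E := by
    unfold surfE
    exact le_iSup₂ (f := fun f _ => ENNReal.ofReal (∫ x in E, div2 f x)) g hmem
  have h2 : ∫ x in E, div2 g x = (C * B)⁻¹ * ∫ x in E, div2 f x := by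
    rw [← integral_const_mul]
    congr 1
    ext x
    exact div2_smul _ f hf x
  have h3 : ∫ x in E, div2 g x ≤ (surfE τ E).toReal := by
    rw [ENNReal.ofReal_le_iff_le_toReal hE] at h1
    exact h1
  rw [h2] at h3
  calc _ = (C * B) * ((C * B)⁻¹ * ∫ x in E, div2 f x) := by field_simp
    _ ≤ (C * B) * (surfE τ E).toReal := by gcongr
    _ = _ := by ring


lemma exists_smooth_cutoff {K U : Set (ℝ × ℝ)} (hK : IsCompact K) (hU : IsOpen U) (hKU : K ⊆ U) :
    ∃ φ : ℝ × ℝ → ℝ, ContDiff ℝ (⊤ : ℕ∞) φ ∧ HasCompactSupport φ ∧ tsupport φ ⊆ U ∧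
      (∀ x ∈ K, φ x = 1) ∧ ∀ x, φ x ∈ Set.Icc (0 : ℝ) 1 := by
  obtain ⟨L, hL, hKL, hLU⟩ := exists_compact_between hK hU hKU
  obtain ⟨f, h1, h2, h3⟩ := exists_contMDiffMap_one_nhds_of_subset_interior (n := (⊤ : ℕ∞))
    (modelWithCornersSelf ℝ (ℝ × ℝ)) hK.isClosed hKL
  have hs : tsupport f ⊆ L := by
    refine closure_minimal ?_ hL.isClosed
    intro x hx
    by_contra h
    exact hx (h2 x h)
  refine ⟨f, f.contMDiff.contDiff, hL.of_isClosed_subset (isClosed_tsupport _) hs, hs.trans hLU,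
    fun x hx => h1.self_of_nhdsSet x hx, h3⟩

lemma div2_smul_const (φ : ℝ × ℝ → ℝ) (hφ : ContDiff ℝ (⊤ : ℕ∞) φ) (h x : ℝ × ℝ) :
    div2 (fun y => φ y • h) x = fderiv ℝ φ x h := by
  have hd : DifferentiableAt ℝ φ x := (hφ.differentiable (by simp)) x
  have h1 : fderiv ℝ (fun y => φ y • h) x = (fderiv ℝ φ x).smulRight h :=
    fderiv_smul_const hd h
  have h2 : h = h.1 • ((1, 0) : ℝ × ℝ) + h.2 • ((0, 1) : ℝ × ℝ) := by
    ext <;> simp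
  simp only [div2, h1, ContinuousLinearMap.smulRight_apply]
  conv_rhs => rw [h2]
  rw [map_add, map_smul, map_smul]
  simp
  ring

lemma transl_smooth {E : Set (ℝ × ℝ)} {P : ℝ} (hE : HP E P) (hP : 0 ≤ P) (hv : volume E ≠ ⊤) (h : ℝ × ℝ)
    (φ : ℝ × ℝ → ℝ) (hφ : ContDiff ℝ (⊤ : ℕ∞) φ) (hc : HasCompactSupport φ)
    (hs : ∀ x ∈ tsupport φ, x ∈ Oq ∧ x + h ∈ Oq) (h01 : ∀ x, φ x ∈ Set.Icc (0 : ℝ) 1) :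
    (∫ x in E, φ x) - ∫ x in E, φ (x - h) ≤ ‖h‖ * P := by
  have : IsFiniteMeasure (volume.restrict E) := ⟨by simpa using hv.lt_top⟩
  have hdφ : Differentiable ℝ φ := hφ.differentiable (by simp)
  have hcd : Continuous (fderiv ℝ φ) := hφ.continuous_fderiv (by simp)
  obtain ⟨D, hD⟩ := (hc.fderiv (𝕜 := ℝ)).exists_bound_of_continuous hcd
  set g : ℝ → ℝ := fun t => ∫ x in E, φ (x - t • h) with hg
  have hder : ∀ t, HasDerivAt g (∫ x in E, -(fderiv ℝ φ (x - t • h) h)) t := by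
    intro t
    refine (hasDerivAt_integral_of_dominated_loc_of_deriv_le (μ := volume.restrict E)
      (F := fun t x => φ (x - t • h)) (F' := fun t x => -(fderiv ℝ φ (x - t • h) h))
      (bound := fun _ => D * ‖h‖) (s := Set.univ) Filter.univ_mem ?_ ?_ ?_ ?_ ?_ ?_).2
    · refine Filter.Eventually.of_forall fun s => ?_
      exact (hφ.continuous.comp (by fun_prop)).aestronglyMeasurable
    · refine Integrable.of_bound (C := 1) (hφ.continuous.comp (by fun_prop)).aestronglyMeasurable ?_
      refine Filter.Eventually.of_forall fun x => ?_
      rw [Real.norm_of_nonneg (h01 _).1]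
      exact (h01 _).2
    · refine Continuous.aestronglyMeasurable ?_
      have : Continuous fun x => fderiv ℝ φ (x - t • h) := hcd.comp (by fun_prop)
      fun_prop
    · refine Filter.Eventually.of_forall fun x s _ => ?_
      rw [norm_neg]
      exact ((fderiv ℝ φ (x - s • h)).le_opNorm h).trans (by gcongr; exact hD _)
    · exact integrable_const _
    · refine Filter.Eventually.of_forall fun x s _ => ?_
      have h1 : HasDerivAt (fun s : ℝ => x - s • h) (-h) s := by
        simpa using ((hasDerivAt_id s).smul_const h).const_sub x
      have h2 := ((hdφ (x - s • h)).hasFDerivAt).comp_hasDerivAt s h1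
      rw [map_neg] at h2
      exact h2
  have hbound : ∀ t ∈ Set.Icc (0 : ℝ) 1, -(‖h‖ * P) ≤ deriv g t := by
    intro t ht
    rw [(hder t).deriv, integral_neg]
    apply neg_le_neg
    set ψ : ℝ × ℝ → ℝ := fun x => φ (x - t • h) with hψ
    have hψs : ContDiff ℝ (⊤ : ℕ∞) ψ := hφ.comp (by fun_prop)
    have htψ : tsupport ψ = (fun x => x - t • h) ⁻¹' tsupport φ := by
      have := tsupport_comp_eq_preimage φ (Homeomorph.subRight (t • h))
      exact this
    have htv : tsupport (fun y => ψ y • h) ⊆ tsupport ψ := by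
      apply closure_mono
      intro x hx hfx
      apply hx
      simp [hfx]
    have hcψ : HasCompactSupport ψ := hc.comp_homeomorph (Homeomorph.subRight (t • h))
    have key := hE ‖h‖ (fun y => ψ y • h) (norm_nonneg _) (hψs.smul contDiff_const)
      (hcψ.of_isClosed_subset (isClosed_tsupport _) htv) ?_ ?_
    · refine le_of_eq_of_le ?_ key
      congr 1
      ext x
      rw [div2_smul_const ψ hψs]
      simp only [hψ]
      rw [fderiv_comp_sub]
    · intro x hx
      have hx' := htv hx
      rw [htψ] at hx'
      obtain ⟨ha, hb⟩ := hs _ hx'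
      have := convex_Oq ha hb (a := 1 - t) (b := t) (by linarith [ht.2]) ht.1 (by ring)
      convert this using 1
      module
    · intro x
      rw [norm_smul, Real.norm_of_nonneg (h01 _).1]
      have := (h01 (x - t • h)).2
      have h0 := norm_nonneg h
      nlinarith
  have hfin := (convex_Icc (0:ℝ) 1).mul_sub_le_image_sub_of_le_deriv (f := g) (C := -(‖h‖ * P))
    (fun t _ => (hder t).continuousAt.continuousWithinAt)
    (fun t _ => (hder t).differentiableAt.differentiableWithinAt)
    (fun t ht => hbound t (interior_subset ht)) 0 (by simp) 1 (by simp) zero_le_one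
  simp only [hg, one_smul, zero_smul, sub_zero] at hfin
  linarith

lemma transl_compact {E : Set (ℝ × ℝ)} {P : ℝ} (hE : HP E P) (hP : 0 ≤ P) (hm : MeasurableSet E)
    (hv : volume E ≠ ⊤) (h : ℝ × ℝ)
    (K : Set (ℝ × ℝ)) (hK : IsCompact K) (hKO : ∀ x ∈ K, x ∈ Oq ∧ x + h ∈ Oq)
    (hKE : ∀ x ∈ K, x ∈ E ∧ x + h ∉ E) : volume K ≤ ENNReal.ofReal (‖h‖ * P) := by
  have : IsFiniteMeasure (volume.restrict E) := ⟨by simpa using hv.lt_top⟩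
  have hKt : volume K ≠ ⊤ := hK.measure_lt_top.ne
  have key : ∀ ε : ℝ, 0 < ε → (volume K).toReal ≤ ‖h‖ * P + ε := by
    intro ε hε
    obtain ⟨U, hKU, hU, hUv⟩ := K.exists_isOpen_lt_add (μ := volume) hKt
      (ε := ENNReal.ofReal ε) (by simpa using hε)
    have hVo : IsOpen {x : ℝ × ℝ | x ∈ Oq ∧ x + h ∈ Oq} :=
      isOpen_Oq.inter (isOpen_Oq.preimage (by fun_prop))
    obtain ⟨φ, h1, h2, h3, h4, h5⟩ := exists_smooth_cutoff hK (hU.inter hVo)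
      (Set.subset_inter hKU hKO)
    have hT := transl_smooth hE hP hv h φ h1 h2 (fun x hx => (h3 hx).2) h5
    have hint : Integrable φ volume := h1.continuous.integrable_of_hasCompactSupport h2
    have hA : (volume K).toReal ≤ ∫ x in E, φ x := by
      have : ∫ x in K, φ x = (volume K).toReal := by
        rw [setIntegral_congr_fun hK.measurableSet (g := fun _ => (1 : ℝ)) h4]
        simp [Measure.real]
      rw [← this]
      exact setIntegral_mono_set hint.integrableOn
        (Filter.Eventually.of_forall fun x => (h5 x).1)
        (Filter.Eventually.of_forall fun x hx => (hKE x hx).1)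
    have hB : ∫ x in E, φ (x - h) ≤ ε := by
      have hsub : Integrable (fun x => φ (x - h)) volume := hint.comp_sub_right h
      -- dominated by the indicator of `(U \ K) + h`
      set W : Set (ℝ × ℝ) := (fun x => x - h) ⁻¹' (U \ K) with hW
      have hWm : MeasurableSet W :=
        (hU.measurableSet.diff hK.measurableSet).preimage (by fun_prop)
      have hWv : volume W = volume (U \ K) := by
        have := measure_preimage_add_right (volume : Measure (ℝ × ℝ)) (-h) (U \ K)
        simp only [hW, sub_eq_add_neg]
        exact this
      have hWε : volume W ≤ ENNReal.ofReal ε := by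
        rw [hWv, measure_sdiff hKU hK.measurableSet.nullMeasurableSet hKt]
        rw [tsub_le_iff_left]
        exact hUv.le
      have hWt : volume W ≠ ⊤ := (hWε.trans_lt ENNReal.ofReal_lt_top).ne
      have hle : ∀ x ∈ E, φ (x - h) ≤ W.indicator (fun _ => (1 : ℝ)) x := by
        intro x hx
        by_cases hxW : x ∈ W
        · rw [Set.indicator_of_mem hxW]; exact (h5 _).2
        · rw [Set.indicator_of_notMem hxW]
          apply le_of_eq
          by_contra hne
          have hmem : x - h ∈ tsupport φ := subset_tsupport _ hne
          apply hxW
          refine ⟨(h3 hmem).1, fun hxK => (hKE _ hxK).2 ?_⟩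
          simpa using hx
      calc ∫ x in E, φ (x - h) ≤ ∫ x in E, W.indicator (fun _ => (1 : ℝ)) x :=
            setIntegral_mono_on hsub.integrableOn
              ((integrable_const (1:ℝ)).indicator hWm) hm hle
        _ ≤ ∫ x, W.indicator (fun _ => (1 : ℝ)) x := by
            refine setIntegral_le_integral ?_ ?_
            · exact (integrable_indicator_iff hWm).2 (integrableOn_const hWt)
            · exact Filter.Eventually.of_forall fun x => Set.indicator_nonneg (fun _ _ => zero_le_one) x
        _ = (volume W).toReal := by
            rw [integral_indicator hWm]; simp [Measure.real]
        _ ≤ ε := ENNReal.toReal_le_of_le_ofReal hε.le hWε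
    linarith
  have := le_of_forall_pos_le_add key
  rw [← ENNReal.ofReal_toReal hKt]
  exact ENNReal.ofReal_le_ofReal this

lemma transl_meas {E : Set (ℝ × ℝ)} {P : ℝ} (hE : HP E P) (hP : 0 ≤ P) (hm : MeasurableSet E)
    (hv : volume E ≠ ⊤) (h : ℝ × ℝ)
    (K : Set (ℝ × ℝ)) (hK : MeasurableSet K) (hKO : ∀ x ∈ K, x ∈ Oq ∧ x + h ∈ Oq)
    (hKE : ∀ x ∈ K, x ∈ E ∧ x + h ∉ E) : volume K ≤ ENNReal.ofReal (‖h‖ * P) := by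
  rw [hK.measure_eq_iSup_isCompact]
  refine iSup_le fun L => iSup_le fun hL => iSup_le fun hLc => ?_
  exact transl_compact hE hP hm hv h L hLc (fun x hx => hKO x (hL hx)) (fun x hx => hKE x (hL hx))

lemma transl_meas' {E : Set (ℝ × ℝ)} {P : ℝ} (hE : HP E P) (hP : 0 ≤ P) (hm : MeasurableSet E)
    (hv : volume E ≠ ⊤) (h : ℝ × ℝ)
    (K : Set (ℝ × ℝ)) (hK : MeasurableSet K) (hKO : ∀ x ∈ K, x ∈ Oq ∧ x + h ∈ Oq)
    (hKE : ∀ x ∈ K, x ∉ E ∧ x + h ∈ E) : volume K ≤ ENNReal.ofReal (‖h‖ * P) := by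
  have h1 := transl_meas hE hP hm hv (-h) ((fun x => x + -h) ⁻¹' K) (hK.preimage (by fun_prop))
    (fun x hx => ⟨by simpa using (hKO _ hx).2, (hKO _ hx).1⟩)
    (fun x hx => ⟨by simpa using (hKE _ hx).2, (hKE _ hx).1⟩)
  rwa [measure_preimage_add_right, norm_neg] at h1


lemma tonelli_bound {S Q : Set (ℝ × ℝ)} {R : Set ((ℝ × ℝ) × (ℝ × ℝ))} (hS : MeasurableSet S)
    (hQ : MeasurableSet Q) (hR : MeasurableSet R) {c : ℝ≥0∞}
    (hc : ∀ h ∈ Q, volume {x | x ∈ S ∧ (x, h) ∈ R} ≤ c) :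
    ∫⁻ x in S, volume {h | h ∈ Q ∧ (x, h) ∈ R} ≤ volume Q * c := by
  have e1 : ∀ x, volume {h | h ∈ Q ∧ (x, h) ∈ R} = ∫⁻ h in Q, R.indicator (fun _ => 1) (x, h) := by
    intro x
    have hm : MeasurableSet {h | (x, h) ∈ R} := hR.preimage (by fun_prop)
    have : (fun h => R.indicator (fun _ => (1 : ℝ≥0∞)) (x, h)) = {h | (x, h) ∈ R}.indicator 1 := by
      ext h
      simp [Set.indicator]
    rw [this, lintegral_indicator_one hm, Measure.restrict_apply hm, Set.inter_comm]
    rfl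
  have e2 : ∀ h, volume {x | x ∈ S ∧ (x, h) ∈ R} = ∫⁻ x in S, R.indicator (fun _ => 1) (x, h) := by
    intro h
    have hm : MeasurableSet {x | (x, h) ∈ R} := hR.preimage (by fun_prop)
    have : (fun x => R.indicator (fun _ => (1 : ℝ≥0∞)) (x, h)) = {x | (x, h) ∈ R}.indicator 1 := by
      ext x
      simp [Set.indicator]
    rw [this, lintegral_indicator_one hm, Measure.restrict_apply hm, Set.inter_comm]
    rfl
  simp_rw [e1]
  rw [lintegral_lintegral_swap]
  · calc ∫⁻ h in Q, ∫⁻ x in S, R.indicator (fun _ => 1) (x, h) ≤ ∫⁻ h in Q, c := by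
          refine setLIntegral_mono' hQ fun h hh => ?_
          rw [← e2]
          exact hc h hh
      _ = volume Q * c := by rw [setLIntegral_const, mul_comm]
  · exact (measurable_const.indicator hR).aemeasurable

/-- Admissible pairs: a region together with a set of translations. -/
structure Adm (S Q : Set (ℝ × ℝ)) (δ : ℝ) : Prop where
  mS : MeasurableSet S
  mQ : MeasurableSet Q
  fin : volume Q ≠ ⊤
  pos : volume Q ≠ 0
  mem : ∀ x ∈ S, ∀ h ∈ Q, x ∈ Oq ∧ x + h ∈ Oq
  le : ∀ h ∈ Q, ‖h‖ ≤ δ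

lemma meas_add {E : Set (ℝ × ℝ)} (hm : MeasurableSet E) :
    MeasurableSet {p : (ℝ × ℝ) × (ℝ × ℝ) | p.1 + p.2 ∈ E} :=
  hm.preimage (by fun_prop)

lemma avg_out {S Q : Set (ℝ × ℝ)} {δ : ℝ} (hA : Adm S Q δ) {E : Set (ℝ × ℝ)} {P : ℝ} (hE : HP E P)
    (hP : 0 ≤ P) (hm : MeasurableSet E) (hv : volume E ≠ ⊤) :
    ∫⁻ x in S ∩ E, volume {h | h ∈ Q ∧ x + h ∉ E} ≤ volume Q * ENNReal.ofReal (δ * P) := by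
  refine tonelli_bound (R := {p | p.1 + p.2 ∈ E}ᶜ) (hA.mS.inter hm) hA.mQ (meas_add hm).compl ?_
  intro h hh
  refine (transl_meas hE hP hm hv h _ ?_ ?_ ?_).trans
    (ENNReal.ofReal_le_ofReal (mul_le_mul_of_nonneg_right (hA.le h hh) hP))
  · exact (hA.mS.inter hm).inter ((meas_add hm).compl.preimage
      (f := fun x : ℝ × ℝ => (x, h)) (by fun_prop))
  · intro x hx
    exact hA.mem x hx.1.1 h hh
  · intro x hx
    exact ⟨hx.1.2, hx.2⟩

lemma avg_in {S Q : Set (ℝ × ℝ)} {δ : ℝ} (hA : Adm S Q δ) {E : Set (ℝ × ℝ)} {P : ℝ} (hE : HP E P)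
    (hP : 0 ≤ P) (hm : MeasurableSet E) (hv : volume E ≠ ⊤) :
    ∫⁻ x in S \ E, volume {h | h ∈ Q ∧ x + h ∈ E} ≤ volume Q * ENNReal.ofReal (δ * P) := by
  refine tonelli_bound (R := {p | p.1 + p.2 ∈ E}) (hA.mS.diff hm) hA.mQ (meas_add hm) ?_
  intro h hh
  refine (transl_meas' hE hP hm hv h _ ?_ ?_ ?_).trans
    (ENNReal.ofReal_le_ofReal (mul_le_mul_of_nonneg_right (hA.le h hh) hP))
  · exact (hA.mS.diff hm).inter ((meas_add hm).preimage
      (f := fun x : ℝ × ℝ => (x, h)) (by fun_prop))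
  · intro x hx
    exact hA.mem x hx.1.1 h hh
  · intro x hx
    exact ⟨hx.1.2, hx.2⟩

lemma split_Q {S Q : Set (ℝ × ℝ)} {δ : ℝ} (hA : Adm S Q δ) {E : Set (ℝ × ℝ)}
    (hm : MeasurableSet E) (x : ℝ × ℝ) :
    volume Q = volume {h | h ∈ Q ∧ x + h ∈ E} + volume {h | h ∈ Q ∧ x + h ∉ E} := by
  have hmx : MeasurableSet {h : ℝ × ℝ | x + h ∈ E} := hm.preimage (by fun_prop)
  rw [← measure_inter_add_sdiff Q hmx]
  rfl

lemma measurable_b {Q : Set (ℝ × ℝ)} (hQ : MeasurableSet Q) {E : Set (ℝ × ℝ)}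
    (hm : MeasurableSet E) : Measurable fun x : ℝ × ℝ => volume {h | h ∈ Q ∧ x + h ∈ E} := by
  have : MeasurableSet {p : (ℝ × ℝ) × (ℝ × ℝ) | p.2 ∈ Q ∧ p.1 + p.2 ∈ E} :=
    (hQ.preimage measurable_snd).inter (meas_add hm)
  exact measurable_measure_prodMk_left this

lemma isop_piece {S Q : Set (ℝ × ℝ)} {δ : ℝ} (hA : Adm S Q δ) {E : Set (ℝ × ℝ)} {P : ℝ}
    (hE : HP E P) (hP : 0 ≤ P) (hm : MeasurableSet E) (hv : volume E ≤ volume Q / 2) :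
    volume (S ∩ E) ≤ 2 * ENNReal.ofReal (δ * P) := by
  have hvt : volume E ≠ ⊤ := (hv.trans_lt (ENNReal.div_lt_top hA.fin (by norm_num))).ne
  have h1 := avg_out hA hE hP hm hvt
  have h2 : volume (S ∩ E) * (volume Q / 2) ≤ volume Q * ENNReal.ofReal (δ * P) := by
    refine le_trans ?_ h1
    rw [mul_comm, ← setLIntegral_const]
    refine lintegral_mono fun x => ?_
    have hx := split_Q hA hm x
    have hy : volume {h | h ∈ Q ∧ x + h ∈ E} ≤ volume Q / 2 := by
      refine le_trans ?_ hv
      have := measure_preimage_add (volume : Measure (ℝ × ℝ)) x E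
      rw [← this]
      exact measure_mono fun h hh => hh.2
    have hq : volume Q / 2 + volume Q / 2 ≤ volume Q / 2 + volume {h | h ∈ Q ∧ x + h ∉ E} := by
      rw [ENNReal.add_halves]
      rw [hx] at hy ⊢
      gcongr
    exact (ENNReal.add_le_add_iff_left (ENNReal.div_lt_top hA.fin (by norm_num)).ne).1 hq
  have h3 : volume Q * volume (S ∩ E) ≤ volume Q * (2 * ENNReal.ofReal (δ * P)) := by
    calc volume Q * volume (S ∩ E) = 2 * (volume (S ∩ E) * (volume Q / 2)) := by
          rw [mul_comm (volume (S ∩ E)), ← mul_assoc, ENNReal.mul_div_cancel (by norm_num) (by norm_num)]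
      _ ≤ 2 * (volume Q * ENNReal.ofReal (δ * P)) := by gcongr
      _ = _ := by ring
  exact (ENNReal.mul_le_mul_iff_right hA.pos hA.fin).1 h3

lemma diff_piece {S Q : Set (ℝ × ℝ)} {δ : ℝ} (hA : Adm S Q δ) {E F : Set (ℝ × ℝ)} {P : ℝ}
    (hE : HP E P) (hF : HP F P) (hP : 0 ≤ P) (hm : MeasurableSet E) (hm' : MeasurableSet F)
    (hv : volume E ≠ ⊤) (hv' : volume F ≠ ⊤) :
    volume (S ∩ (E \ F)) * volume Q ≤ 2 * (volume Q * ENNReal.ofReal (δ * P)) +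
      ∫⁻ x in S, (volume {h | h ∈ Q ∧ x + h ∈ E} - volume {h | h ∈ Q ∧ x + h ∈ F}) := by
  have h1 := avg_out hA hE hP hm hv
  have h2 := avg_in hA hF hP hm' hv'
  have mo : Measurable fun x : ℝ × ℝ => volume {h | h ∈ Q ∧ x + h ∉ E} :=
    measurable_b hA.mQ hm.compl
  have mF := measurable_b hA.mQ hm'
  rw [mul_comm, ← setLIntegral_const]
  calc ∫⁻ x in S ∩ (E \ F), volume Q
      ≤ ∫⁻ x in S ∩ (E \ F), (volume {h | h ∈ Q ∧ x + h ∉ E} + (volume {h | h ∈ Q ∧ x + h ∈ F} +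
        (volume {h | h ∈ Q ∧ x + h ∈ E} - volume {h | h ∈ Q ∧ x + h ∈ F}))) := by
        refine lintegral_mono fun x => ?_
        rw [split_Q hA hm x, add_comm]
        gcongr
        exact le_add_tsub
    _ = (∫⁻ x in S ∩ (E \ F), volume {h | h ∈ Q ∧ x + h ∉ E}) +
        ((∫⁻ x in S ∩ (E \ F), volume {h | h ∈ Q ∧ x + h ∈ F}) +
        ∫⁻ x in S ∩ (E \ F),
          (volume {h | h ∈ Q ∧ x + h ∈ E} - volume {h | h ∈ Q ∧ x + h ∈ F})) := by
        rw [lintegral_add_left mo, lintegral_add_left mF]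
    _ ≤ (volume Q * ENNReal.ofReal (δ * P)) + ((volume Q * ENNReal.ofReal (δ * P)) +
      ∫⁻ x in S, (volume {h | h ∈ Q ∧ x + h ∈ E} - volume {h | h ∈ Q ∧ x + h ∈ F})) := by
        gcongr
        · refine le_trans (lintegral_mono_set ?_) h1
          exact fun x hx => ⟨hx.1, hx.2.1⟩
        · refine le_trans (lintegral_mono_set ?_) h2
          exact fun x hx => ⟨hx.1, hx.2.2⟩
        · exact inter_subset_left
    _ = _ := by ring

/-- One-dimensional halves of `(-1,1)`. -/
def Ih (i : Bool) : Set ℝ := if i then Set.Ioc (-1) 0 else Set.Ico 0 1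

/-- One-dimensional translation sets pointing to the centre. -/
def Jh (δ : ℝ) (i : Bool) : Set ℝ := if i then Set.Icc 0 δ else Set.Icc (-δ) 0

lemma adm_IJ {δ : ℝ} (h0 : 0 < δ) (h1 : δ < 1) (i j : Bool) :
    Adm (Ih i ×ˢ Ih j) (Jh δ i ×ˢ Jh δ j) δ := by
  have mI : ∀ i, MeasurableSet (Ih i) := by
    intro i; cases i <;> simp [Ih]
  have mJ : ∀ i, MeasurableSet (Jh δ i) := by
    intro i; cases i <;> simp [Jh]
  have vJ : ∀ i, volume (Jh δ i) = ENNReal.ofReal δ := by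
    intro i; cases i <;> simp [Jh]
  have key : ∀ i, ∀ x ∈ Ih i, ∀ h ∈ Jh δ i, x ∈ Set.Ioo (-1 : ℝ) 1 ∧ x + h ∈ Set.Ioo (-1 : ℝ) 1 := by
    intro i x hx h hh
    cases i <;> simp [Ih, Jh] at hx hh <;> simp only [Set.mem_Ioo] <;>
      refine ⟨⟨?_, ?_⟩, ?_, ?_⟩ <;> linarith
  have keyn : ∀ i, ∀ h ∈ Jh δ i, |h| ≤ δ := by
    intro i h hh
    rw [abs_le]
    cases i <;> simp [Jh] at hh <;> constructor <;> linarith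
  refine ⟨(mI i).prod (mI j), (mJ i).prod (mJ j), ?_, ?_, ?_, ?_⟩
  · rw [Measure.volume_eq_prod, Measure.prod_prod, vJ, vJ]
    exact ENNReal.mul_ne_top ENNReal.ofReal_ne_top ENNReal.ofReal_ne_top
  · rw [Measure.volume_eq_prod, Measure.prod_prod, vJ, vJ]
    simp [h0]
  · rintro x ⟨hx, hx'⟩ h ⟨hh, hh'⟩
    exact ⟨⟨(key i _ hx _ hh).1, (key j _ hx' _ hh').1⟩, ⟨(key i _ hx _ hh).2, (key j _ hx' _ hh').2⟩⟩
  · rintro h ⟨hh, hh'⟩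
    exact max_le (keyn i _ hh) (keyn j _ hh')

lemma vol_JJ {δ : ℝ} (i j : Bool) :
    volume (Jh δ i ×ˢ Jh δ j) = ENNReal.ofReal δ * ENNReal.ofReal δ := by
  have vJ : ∀ i, volume (Jh δ i) = ENNReal.ofReal δ := by
    intro i; cases i <;> simp [Jh]
  rw [Measure.volume_eq_prod, Measure.prod_prod, vJ, vJ]

lemma cover_Oq (A : Set (ℝ × ℝ)) (hA : A ⊆ Oq) :
    volume A ≤ ∑ p : Bool × Bool, volume ((Ih p.1 ×ˢ Ih p.2) ∩ A) := by
  have : A ⊆ ⋃ p ∈ (Finset.univ : Finset (Bool × Bool)), ((Ih p.1 ×ˢ Ih p.2) ∩ A) := by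
    intro x hx
    have hI : ∀ y ∈ Set.Ioo (-1 : ℝ) 1, ∃ i, y ∈ Ih i := by
      intro y hy
      rcases le_total y 0 with h | h
      · exact ⟨true, by simp [Ih, hy.1, h]⟩
      · exact ⟨false, by simp [Ih, hy.2, h]⟩
    obtain ⟨i, hi⟩ := hI _ (hA hx).1
    obtain ⟨j, hj⟩ := hI _ (hA hx).2
    simp only [Set.mem_iUnion]
    exact ⟨(i, j), Finset.mem_univ _, ⟨hi, hj⟩, hx⟩
  exact (measure_mono this).trans (measure_biUnion_finset_le _ _)

lemma isop {δ : ℝ} (h0 : 0 < δ) (h1 : δ < 1) {E : Set (ℝ × ℝ)} {P : ℝ} (hEO : E ⊆ Oq)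
    (hE : HP E P) (hP : 0 ≤ P) (hm : MeasurableSet E)
    (hv : volume E ≤ ENNReal.ofReal δ * ENNReal.ofReal δ / 2) :
    volume E ≤ 8 * ENNReal.ofReal (δ * P) := by
  refine (cover_Oq E hEO).trans ?_
  calc _ ≤ ∑ p : Bool × Bool, 2 * ENNReal.ofReal (δ * P) := by
        refine Finset.sum_le_sum fun p _ => ?_
        exact isop_piece (adm_IJ h0 h1 p.1 p.2) hE hP hm (by rwa [vol_JJ])
    _ = _ := by simp; ring


lemma weak_extract (E : ℕ → Set (ℝ × ℝ)) :
    ∃ φ : ℕ → ℕ, StrictMono φ ∧ ∀ g : ℝ × ℝ → ℝ, Integrable g volume →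
      ∃ l : ℝ, Tendsto (fun n => ∫ x in E (φ n), g x) atTop (nhds l) := by
  have : Fact ((1 : ℝ≥0∞) ≤ 1) := ⟨le_rfl⟩
  have : Fact ((1 : ℝ≥0∞) ≠ ⊤) := ⟨by norm_num⟩
  let d : ℕ → Lp ℝ 1 (volume : Measure (ℝ × ℝ)) := TopologicalSpace.denseSeq _
  have hd : DenseRange d := TopologicalSpace.denseRange_denseSeq _
  have hdi : ∀ j, Integrable (d j) volume := fun j => L1.integrable_coeFn (d j)
  have hbd : ∀ (A : Set (ℝ × ℝ)) (g : ℝ × ℝ → ℝ), Integrable g volume →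
      |∫ x in A, g x| ≤ ∫ x, |g x| := by
    intro A g hg
    calc |∫ x in A, g x| ≤ ∫ x in A, |g x| := abs_integral_le_integral_abs
      _ ≤ ∫ x, |g x| := setIntegral_le_integral hg.abs (Filter.Eventually.of_forall fun x => abs_nonneg _)
  let u : ℕ → ℕ → ℝ := fun n j => ∫ x in E n, d j x
  have hcomp : IsCompact (Set.univ.pi fun j => Set.Icc (-∫ x, |d j x|) (∫ x, |d j x|)) :=
    isCompact_univ_pi fun j => isCompact_Icc
  obtain ⟨l, -, φ, hφ, hl⟩ := hcomp.tendsto_subseq (x := u)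
    (fun n j _ => abs_le.1 (hbd (E n) (d j) (hdi j)))
  refine ⟨φ, hφ, fun g hg => ?_⟩
  apply cauchySeq_tendsto_of_complete
  rw [Metric.cauchySeq_iff]
  intro ε hε
  obtain ⟨j, hj⟩ := hd.exists_dist_lt (hg.toL1 g) (show 0 < ε / 3 by positivity)
  have hj' : ∫ x, |g x - d j x| < ε / 3 := by
    rw [dist_eq_norm, L1.norm_eq_integral_norm] at hj
    refine lt_of_eq_of_lt (integral_congr_ae ?_) hj
    filter_upwards [Lp.coeFn_sub (hg.toL1 g) (d j), hg.coeFn_toL1] with x h1 h2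
    rw [h1, Pi.sub_apply, h2, Real.norm_eq_abs]
  have hcl : ∀ n, |(∫ x in E n, g x) - ∫ x in E n, d j x| < ε / 3 := by
    intro n
    rw [← integral_sub hg.integrableOn (hdi j).integrableOn]
    exact (hbd (E n) _ (hg.sub (hdi j))).trans_lt hj'
  have hcj : CauchySeq fun n => ∫ x in E (φ n), d j x :=
    ((tendsto_pi_nhds.1 hl) j).cauchySeq
  rw [Metric.cauchySeq_iff] at hcj
  obtain ⟨N, hN⟩ := hcj (ε / 3) (by positivity)
  refine ⟨N, fun m hm n hn => ?_⟩
  have h1 := hN m hm n hn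
  rw [Real.dist_eq, abs_lt] at h1 ⊢
  have h2 := abs_lt.1 (hcl (φ m))
  have h3 := abs_lt.1 (hcl (φ n))
  constructor <;> linarith [h1.1, h1.2, h2.1, h2.2, h3.1, h3.2]

lemma b_tendsto {Q : Set (ℝ × ℝ)} (hQ : MeasurableSet Q) (hQt : volume Q ≠ ⊤)
    (E : ℕ → Set (ℝ × ℝ)) (hm : ∀ n, MeasurableSet (E n))
    (hw : ∀ g : ℝ × ℝ → ℝ, Integrable g volume →
      ∃ l : ℝ, Tendsto (fun n => ∫ x in E n, g x) atTop (nhds l)) (x : ℝ × ℝ) :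
    ∃ l : ℝ≥0∞, l ≠ ⊤ ∧ Tendsto (fun n => volume {h | h ∈ Q ∧ x + h ∈ E n}) atTop (nhds l) := by
  set T : Set (ℝ × ℝ) := (fun y => -x + y) ⁻¹' Q with hT
  have hTm : MeasurableSet T := hQ.preimage (by fun_prop)
  have hTv : volume T = volume Q := measure_preimage_add _ _ _
  have hTt : volume T ≠ ⊤ := hTv ▸ hQt
  obtain ⟨l, hl⟩ := hw (T.indicator fun _ => 1)
    ((integrable_indicator_iff hTm).2 (integrableOn_const hTt))
  refine ⟨ENNReal.ofReal l, ENNReal.ofReal_ne_top, ?_⟩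
  refine (ENNReal.tendsto_ofReal hl).congr fun n => ?_
  rw [integral_indicator hTm, Measure.restrict_restrict hTm]
  have e1 : volume {h | h ∈ Q ∧ x + h ∈ E n} = volume (T ∩ E n) := by
    rw [← measure_preimage_add (volume : Measure (ℝ × ℝ)) x (T ∩ E n)]
    congr 1
    ext h
    simp [hT]
  have e2 : volume (T ∩ E n) ≠ ⊤ := ((measure_mono inter_subset_left).trans_lt hTt.lt_top).ne
  rw [e1]
  simp [Measure.real, ENNReal.ofReal_toReal e2]

lemma lint_cauchy {S Q : Set (ℝ × ℝ)} {δ : ℝ} (hA : Adm S Q δ) (hS : volume S ≠ ⊤)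
    (E : ℕ → Set (ℝ × ℝ)) (hm : ∀ n, MeasurableSet (E n))
    (hw : ∀ g : ℝ × ℝ → ℝ, Integrable g volume →
      ∃ l : ℝ, Tendsto (fun n => ∫ x in E n, g x) atTop (nhds l)) {ε : ℝ≥0∞} (hε : 0 < ε) :
    ∃ N, ∀ n ≥ N, ∀ m ≥ N, ∫⁻ x in S, (volume {h | h ∈ Q ∧ x + h ∈ E n} -
      volume {h | h ∈ Q ∧ x + h ∈ E m}) ≤ ε := by
  choose b hbt hb using b_tendsto hA.mQ hA.fin E hm hw
  set B : ℕ → ℝ × ℝ → ℝ≥0∞ := fun n x => volume {h | h ∈ Q ∧ x + h ∈ E n} with hB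
  have mB : ∀ n, Measurable (B n) := fun n => measurable_b hA.mQ (hm n)
  have mb : Measurable b := measurable_of_tendsto_metrizable mB (tendsto_pi_nhds.2 hb)
  have hBQ : ∀ n x, B n x ≤ volume Q := fun n x => measure_mono fun h hh => hh.1
  have hbQ : ∀ x, b x ≤ volume Q := fun x => le_of_tendsto' (hb x) fun n => hBQ n x
  have hfin : ∫⁻ x in S, volume Q ≠ ⊤ := by
    rw [setLIntegral_const]
    exact ENNReal.mul_ne_top hA.fin hS
  have t1 : Tendsto (fun n => ∫⁻ x in S, (B n x - b x)) atTop (nhds 0) := by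
    have := tendsto_lintegral_of_dominated_convergence (μ := volume.restrict S)
      (F := fun n x => B n x - b x) (f := fun _ => 0) (fun _ => volume Q)
      (fun n => (mB n).sub mb)
      (fun n => Filter.Eventually.of_forall fun x => tsub_le_self.trans (hBQ n x)) hfin
      (Filter.Eventually.of_forall fun x => by
        have := ENNReal.Tendsto.sub (hb x) (tendsto_const_nhds (x := b x)) (Or.inl (hbt x))
        simpa using this)
    simpa using this
  have t2 : Tendsto (fun n => ∫⁻ x in S, (b x - B n x)) atTop (nhds 0) := by
    have := tendsto_lintegral_of_dominated_convergence (μ := volume.restrict S)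
      (F := fun n x => b x - B n x) (f := fun _ => 0) (fun _ => volume Q)
      (fun n => mb.sub (mB n))
      (fun n => Filter.Eventually.of_forall fun x => tsub_le_self.trans (hbQ x)) hfin
      (Filter.Eventually.of_forall fun x => by
        have := ENNReal.Tendsto.sub (tendsto_const_nhds (x := b x)) (hb x) (Or.inl (hbt x))
        simpa using this)
    simpa using this
  have hε2 : 0 < ε / 2 := ENNReal.half_pos hε.ne'
  have e1 := (t1.eventually (gt_mem_nhds hε2)).and (t2.eventually (gt_mem_nhds hε2))
  obtain ⟨N, hN⟩ := Filter.eventually_atTop.1 e1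
  refine ⟨N, fun n hn m hm' => ?_⟩
  calc ∫⁻ x in S, (B n x - B m x) ≤ ∫⁻ x in S, ((B n x - b x) + (b x - B m x)) :=
        lintegral_mono fun x => tsub_le_tsub_add_tsub
    _ = (∫⁻ x in S, (B n x - b x)) + ∫⁻ x in S, (b x - B m x) :=
        lintegral_add_left ((mB n).sub mb) _
    _ ≤ ε / 2 + ε / 2 := add_le_add (hN n hn).1.le (hN m hm').2.le
    _ = ε := ENNReal.add_halves ε

lemma sets_cauchy (E : ℕ → Set (ℝ × ℝ)) (hm : ∀ n, MeasurableSet (E n)) (hO : ∀ n, E n ⊆ Oq)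
    {P : ℝ} (hP : 0 ≤ P) (hE : ∀ n, HP (E n) P)
    (hw : ∀ g : ℝ × ℝ → ℝ, Integrable g volume →
      ∃ l : ℝ, Tendsto (fun n => ∫ x in E n, g x) atTop (nhds l)) {ε : ℝ} (hε : 0 < ε) :
    ∃ N, ∀ n ≥ N, ∀ m ≥ N, volume (E n \ E m) ≤ ENNReal.ofReal ε := by
  have hvt : ∀ n, volume (E n) ≠ ⊤ := fun n =>
    ((measure_mono (hO n)).trans_lt (by rw [volume_Oq]; norm_num)).ne
  obtain ⟨δ, h0, h1, hδ⟩ : ∃ δ : ℝ, 0 < δ ∧ δ < 1 ∧ δ * P ≤ ε / 16 := by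
    refine ⟨min (1 / 2) (ε / (16 * (P + 1))), by positivity,
      (min_le_left _ _).trans_lt (by norm_num), ?_⟩
    calc min (1 / 2) (ε / (16 * (P + 1))) * P ≤ ε / (16 * (P + 1)) * (P + 1) :=
          mul_le_mul (min_le_right _ _) (by linarith) hP (by positivity)
      _ = ε / 16 := by field_simp
  set q := ENNReal.ofReal δ * ENNReal.ofReal δ with hq
  have hq0 : q ≠ 0 := by simp [hq, h0]
  have hqt : q ≠ ⊤ := ENNReal.mul_ne_top ENNReal.ofReal_ne_top ENNReal.ofReal_ne_top
  have hpos : 0 < q * ENNReal.ofReal (ε / 8) := by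
    apply ENNReal.mul_pos hq0
    simpa using hε
  have hSt : ∀ p : Bool × Bool, volume (Ih p.1 ×ˢ Ih p.2) ≠ ⊤ := by
    intro p
    refine ((measure_mono (t := Oq) ?_).trans_lt (by rw [volume_Oq]; norm_num)).ne
    intro x hx
    have hA := adm_IJ h0 h1 p.1 p.2
    obtain ⟨h, hh⟩ := nonempty_of_measure_ne_zero hA.pos
    exact (hA.mem x hx h hh).1
  choose N hN using fun p : Bool × Bool =>
    lint_cauchy (adm_IJ h0 h1 p.1 p.2) (hSt p) E hm hw hpos
  refine ⟨Finset.univ.sup N, fun n hn m hm' => ?_⟩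
  refine (cover_Oq _ (sdiff_subset.trans (hO n))).trans ?_
  have hpiece : ∀ p : Bool × Bool,
      volume ((Ih p.1 ×ˢ Ih p.2) ∩ (E n \ E m)) ≤ ENNReal.ofReal (ε / 4) := by
    intro p
    have d1 := diff_piece (adm_IJ h0 h1 p.1 p.2) (hE n) (hE m) hP (hm n) (hm m) (hvt n) (hvt m)
    have d2 := hN p n ((Finset.le_sup (Finset.mem_univ p)).trans hn) m
      ((Finset.le_sup (Finset.mem_univ p)).trans hm')
    have d3 := d1.trans (add_le_add_right d2 _)
    rw [vol_JJ, ← hq] at d3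
    have d4 : q * volume ((Ih p.1 ×ˢ Ih p.2) ∩ (E n \ E m)) ≤ q * ENNReal.ofReal (ε / 4) := by
      rw [mul_comm]
      refine d3.trans ?_
      calc 2 * (q * ENNReal.ofReal (δ * P)) + q * ENNReal.ofReal (ε / 8)
          ≤ 2 * (q * ENNReal.ofReal (ε / 16)) + q * ENNReal.ofReal (ε / 8) := by gcongr
        _ = q * (ENNReal.ofReal 2 * ENNReal.ofReal (ε / 16) + ENNReal.ofReal (ε / 8)) := by
            rw [ENNReal.ofReal_ofNat]; ring
        _ = q * ENNReal.ofReal (ε / 4) := by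
            rw [← ENNReal.ofReal_mul (by norm_num), ← ENNReal.ofReal_add (by positivity) (by positivity)]
            congr 2
            ring
    exact (ENNReal.mul_le_mul_iff_right hq0 hqt).1 d4
  calc _ ≤ ∑ p : Bool × Bool, ENNReal.ofReal (ε / 4) := Finset.sum_le_sum fun p _ => hpiece p
    _ = ENNReal.ofReal 4 * ENNReal.ofReal (ε / 4) := by simp
    _ = ENNReal.ofReal ε := by
        rw [← ENNReal.ofReal_mul (by norm_num)]
        congr 1
        ring

lemma compactness (E : ℕ → Set (ℝ × ℝ)) (hm : ∀ n, MeasurableSet (E n)) (hO : ∀ n, E n ⊆ Oq)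
    {P : ℝ} (hP : 0 ≤ P) (hE : ∀ n, HP (E n) P) :
    ∃ φ : ℕ → ℕ, StrictMono φ ∧ ∃ F : Set (ℝ × ℝ), MeasurableSet F ∧ F ⊆ Oq ∧
      ∀ g : ℝ × ℝ → ℝ, Integrable g volume →
        Tendsto (fun n => ∫ x in E (φ n), g x) atTop (nhds (∫ x in F, g x)) := by
  obtain ⟨φ, hφ, hw⟩ := weak_extract E
  have hc := fun k : ℕ => sets_cauchy (fun n => E (φ n)) (fun n => hm _) (fun n => hO _) hP
    (fun n => hE _) hw (ε := (1 / 2) ^ k) (by positivity)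
  have hev : ∀ k : ℕ, ∀ᶠ n in atTop, ∀ m ≥ n,
      volume (symmDiff (E (φ n)) (E (φ m))) ≤ 2 * ENNReal.ofReal ((1 / 2) ^ k) := by
    intro k
    obtain ⟨N, hN⟩ := hc k
    filter_upwards [Filter.eventually_ge_atTop N] with n hn m hm'
    have a1 := hN n hn m (hn.trans hm')
    have a2 := hN m (hn.trans hm') n hn
    rw [two_mul, symmDiff_def]
    exact (measure_union_le _ _).trans (add_le_add a1 a2)
  obtain ⟨ψ, hψ, hψ'⟩ := Filter.extraction_forall_of_eventually hev
  set G : ℕ → Set (ℝ × ℝ) := fun n => E (φ (ψ n)) with hG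
  have hGs : ∀ n, volume (symmDiff (G n) (G (n + 1))) ≤ 2 * ENNReal.ofReal ((1 / 2) ^ n) :=
    fun n => hψ' n _ (hψ n.lt_succ_self).le
  have hsum : ∑' n, volume (symmDiff (G n) (G (n + 1))) ≠ ⊤ := by
    refine ((ENNReal.tsum_le_tsum hGs).trans_lt ?_).ne
    rw [ENNReal.tsum_mul_left, ← ENNReal.ofReal_tsum_of_nonneg (fun n => by positivity)
      summable_geometric_two]
    exact ENNReal.mul_lt_top (by norm_num) ENNReal.ofReal_lt_top
  have hae : ∀ᵐ x, ∀ᶠ n in atTop, x ∉ symmDiff (G n) (G (n + 1)) :=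
    ae_eventually_notMem hsum
  set F : Set (ℝ × ℝ) := {x | ∀ᶠ n in atTop, x ∈ G n} with hF
  have hFm : MeasurableSet F := by
    have : F = liminf G atTop := by
      rw [Filter.liminf_eq_iSup_iInf_of_nat]
      ext x
      simp [hF, Filter.eventually_atTop]
    rw [this]
    exact MeasurableSet.measurableSet_liminf fun n => hm _
  have hconst : ∀ᵐ x, ∀ᶠ n in atTop, (x ∈ G n ↔ x ∈ F) := by
    filter_upwards [hae] with x hx
    obtain ⟨N, hN⟩ := Filter.eventually_atTop.1 hx
    have hst : ∀ n ≥ N, (x ∈ G n ↔ x ∈ G N) := by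
      intro n hn
      induction n, hn using Nat.le_induction with
      | base => rfl
      | succ n hn ih =>
        rw [← ih]
        have := hN n hn
        rw [Set.mem_symmDiff] at this
        tauto
    have hFN : x ∈ F ↔ x ∈ G N := by
      constructor
      · intro h
        obtain ⟨M, hM⟩ := Filter.eventually_atTop.1 h
        exact (hst (max M N) (le_max_right _ _)).1 (hM _ (le_max_left _ _))
      · intro h
        exact Filter.eventually_atTop.2 ⟨N, fun n hn => (hst n hn).2 h⟩
    exact Filter.eventually_atTop.2 ⟨N, fun n hn => (hst n hn).trans hFN.symm⟩
  refine ⟨φ ∘ ψ, hφ.comp hψ, F, hFm, ?_, ?_⟩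
  · intro x hx
    obtain ⟨n, hn⟩ := hx.exists
    exact hO _ hn
  · intro g hg
    have hGm : ∀ n, MeasurableSet (G n) := fun n => hm _
    change Tendsto (fun n => ∫ x in G n, g x) atTop _
    simp_rw [← fun n => integral_indicator (f := g) (μ := volume) (hGm n)]
    rw [← integral_indicator hFm]
    refine tendsto_integral_of_dominated_convergence (fun x => ‖g x‖) ?_ hg.norm ?_ ?_
    · exact fun n => hg.aestronglyMeasurable.indicator (hGm n)
    · exact fun n => Filter.Eventually.of_forall fun x => norm_indicator_le_norm_self _ _
    · filter_upwards [hconst] with x hx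
      refine tendsto_const_nhds.congr' ?_
      filter_upwards [hx] with n hn
      by_cases h : x ∈ F
      · rw [Set.indicator_of_mem h, Set.indicator_of_mem (hn.2 h)]
      · rw [Set.indicator_of_notMem h, Set.indicator_of_notMem (fun h' => h (hn.1 h'))]


/-- One-dimensional cutoff. -/
noncomputable def eta (k s : ℝ) : ℝ := Real.smoothTransition (k * (1 - s) - 1) * Real.smoothTransition (k * (1 + s) - 1)

/-- Bound on the derivative of the cutoff. -/
noncomputable def kap (k s : ℝ) : ℝ := k * deriv Real.smoothTransition (k * (1 - s) - 1) +
  k * deriv Real.smoothTransition (k * (1 + s) - 1)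

lemma eta_contDiff (k : ℝ) : ContDiff ℝ (⊤ : ℕ∞) (eta k) := by
  unfold eta
  exact (Real.smoothTransition.contDiff.comp (by fun_prop)).mul
    (Real.smoothTransition.contDiff.comp (by fun_prop))

lemma eta_mem (k s : ℝ) : eta k s ∈ Set.Icc (0 : ℝ) 1 :=
  ⟨mul_nonneg (Real.smoothTransition.nonneg _) (Real.smoothTransition.nonneg _),
    mul_le_one₀ (Real.smoothTransition.le_one _) (Real.smoothTransition.nonneg _)
      (Real.smoothTransition.le_one _)⟩

lemma eta_supp {k : ℝ} (hk : 0 < k) {s : ℝ} (h : eta k s ≠ 0) :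
    s ∈ Set.Icc (-(1 - 1 / k)) (1 - 1 / k) := by
  have h1 : ¬ (k * (1 - s) - 1 ≤ 0) := fun h' => h (by
    rw [eta, Real.smoothTransition.zero_of_nonpos h', zero_mul])
  have h2 : ¬ (k * (1 + s) - 1 ≤ 0) := fun h' => h (by
    rw [eta, Real.smoothTransition.zero_of_nonpos h', mul_zero])
  push Not at h1 h2
  have h3 : 1 / k < 1 - s := by rw [div_lt_iff₀ hk]; linarith
  have h4 : 1 / k < 1 + s := by rw [div_lt_iff₀ hk]; linarith
  constructor <;> linarith

lemma eta_one {s : ℝ} (hs : s ∈ Set.Ioo (-1 : ℝ) 1) :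
    ∀ᶠ n : ℕ in atTop, eta ((n : ℝ) + 1) s = 1 := by
  have key : ∀ t : ℝ, 0 < t → ∀ᶠ n : ℕ in atTop, 1 ≤ ((n : ℝ) + 1) * t - 1 := by
    intro t ht
    have : Tendsto (fun n : ℕ => ((n : ℝ) + 1) * t) atTop atTop :=
      (tendsto_atTop_add_const_right _ _ tendsto_natCast_atTop_atTop).atTop_mul_const ht
    filter_upwards [this.eventually_ge_atTop 2] with n hn
    linarith
  filter_upwards [key (1 - s) (by linarith [hs.2]), key (1 + s) (by linarith [hs.1])] with n h1 h2
  rw [eta, Real.smoothTransition.one_of_one_le h1, Real.smoothTransition.one_of_one_le h2, mul_one]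

lemma st_diff : Differentiable ℝ Real.smoothTransition :=
  (Real.smoothTransition.contDiff (n := 1)).differentiable (by simp)

lemma st_deriv_cont : Continuous (deriv Real.smoothTransition) :=
  (Real.smoothTransition.contDiff (n := 1)).continuous_deriv (by simp)

lemma st_deriv_nonneg (x : ℝ) : 0 ≤ deriv Real.smoothTransition x :=
  Real.smoothTransition.monotone.deriv_nonneg

lemma st_comp1 (k s : ℝ) : HasDerivAt (fun s => Real.smoothTransition (k * (1 - s) - 1))
    (-(k * deriv Real.smoothTransition (k * (1 - s) - 1))) s := by
  have h1 : HasDerivAt (fun s : ℝ => k * (1 - s) - 1) (-k) s := by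
    have := (((hasDerivAt_id s).const_sub 1).const_mul k).sub_const 1
    simpa using this
  have h2 := (st_diff (k * (1 - s) - 1)).hasDerivAt.comp s h1
  exact h2.congr_deriv (by ring)

lemma st_comp2 (k s : ℝ) : HasDerivAt (fun s => Real.smoothTransition (k * (1 + s) - 1))
    (k * deriv Real.smoothTransition (k * (1 + s) - 1)) s := by
  have h1 : HasDerivAt (fun s : ℝ => k * (1 + s) - 1) k s := by
    have := (((hasDerivAt_id s).const_add 1).const_mul k).sub_const 1
    simpa using this
  have h2 := (st_diff (k * (1 + s) - 1)).hasDerivAt.comp s h1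
  exact h2.congr_deriv (by ring)

lemma kap_cont (k : ℝ) : Continuous (kap k) := by
  unfold kap
  have := st_deriv_cont
  fun_prop

lemma kap_nonneg {k : ℝ} (hk : 0 < k) (s : ℝ) : 0 ≤ kap k s :=
  add_nonneg (mul_nonneg hk.le (st_deriv_nonneg _)) (mul_nonneg hk.le (st_deriv_nonneg _))

lemma eta_deriv_le {k : ℝ} (hk : 0 < k) (s : ℝ) : |deriv (eta k) s| ≤ kap k s := by
  have h := (st_comp1 k s).mul (st_comp2 k s)
  have h' : deriv (eta k) s = _ := h.deriv
  rw [h', kap]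
  set A := k * deriv Real.smoothTransition (k * (1 - s) - 1)
  set B := k * deriv Real.smoothTransition (k * (1 + s) - 1)
  have hA : 0 ≤ A := mul_nonneg hk.le (st_deriv_nonneg _)
  have hB : 0 ≤ B := mul_nonneg hk.le (st_deriv_nonneg _)
  have a0 := Real.smoothTransition.nonneg (k * (1 - s) - 1)
  have a1 := Real.smoothTransition.le_one (k * (1 - s) - 1)
  have b0 := Real.smoothTransition.nonneg (k * (1 + s) - 1)
  have b1 := Real.smoothTransition.le_one (k * (1 + s) - 1)
  rw [abs_le]
  constructor <;> nlinarith

lemma kap_int (k : ℝ) : ∫ s in Set.Ioo (-1 : ℝ) 1, kap k s ≤ 2 := by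
  rw [← integral_Ioc_eq_integral_Ioo, ← intervalIntegral.integral_of_le (by norm_num)]
  have hd : ∀ s ∈ Set.uIcc (-1 : ℝ) 1, HasDerivAt (fun s => Real.smoothTransition (k * (1 + s) - 1) -
      Real.smoothTransition (k * (1 - s) - 1)) (kap k s) s := by
    intro s _
    exact ((st_comp2 k s).sub (st_comp1 k s)).congr_deriv (by simp only [kap]; ring)
  rw [intervalIntegral.integral_eq_sub_of_hasDerivAt hd ((kap_cont k).intervalIntegrable _ _)]
  have n1 := Real.smoothTransition.le_one (k * (1 + 1) - 1)
  have n2 := Real.smoothTransition.nonneg (k * (1 - 1) - 1)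
  have n3 := Real.smoothTransition.nonneg (k * (1 + -1) - 1)
  have n4 := Real.smoothTransition.le_one (k * (1 - -1) - 1)
  linarith

lemma div2_cont {f : ℝ × ℝ → ℝ × ℝ} (hf : ContDiff ℝ (⊤ : ℕ∞) f) : Continuous (div2 f) := by
  have : Continuous (fderiv ℝ f) := hf.continuous_fderiv (by simp)
  unfold div2
  fun_prop

lemma div2_integrable {f : ℝ × ℝ → ℝ × ℝ} (hf : ContDiff ℝ (⊤ : ℕ∞) f) (hc : HasCompactSupport f) :
    Integrable (div2 f) volume := by
  refine (div2_cont hf).integrable_of_hasCompactSupport ?_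
  refine (hc.fderiv (𝕜 := ℝ)).mono fun x hx hfx => hx ?_
  simp [div2, hfx]

/-- Two-dimensional cutoff. -/
noncomputable def chi (k : ℝ) (x : ℝ × ℝ) : ℝ := eta k x.1 * eta k x.2

lemma chi_contDiff (k : ℝ) : ContDiff ℝ (⊤ : ℕ∞) (chi k) := by
  unfold chi
  exact ((eta_contDiff k).comp contDiff_fst).mul ((eta_contDiff k).comp contDiff_snd)

lemma chi_mem (k : ℝ) (x : ℝ × ℝ) : chi k x ∈ Set.Icc (0 : ℝ) 1 :=
  ⟨mul_nonneg (eta_mem _ _).1 (eta_mem _ _).1,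
    mul_le_one₀ (eta_mem _ _).2 (eta_mem _ _).1 (eta_mem _ _).2⟩

lemma chi_deriv (k : ℝ) (x v : ℝ × ℝ) : fderiv ℝ (chi k) x v =
    eta k x.1 * (deriv (eta k) x.2 * v.2) + eta k x.2 * (deriv (eta k) x.1 * v.1) := by
  have hd : Differentiable ℝ (eta k) := (eta_contDiff k).differentiable (by simp)
  have h1 : HasFDerivAt (fun x : ℝ × ℝ => eta k x.1)
      (deriv (eta k) x.1 • ContinuousLinearMap.fst ℝ ℝ ℝ) x :=
    (hd x.1).hasDerivAt.comp_hasFDerivAt x hasFDerivAt_fst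
  have h2 : HasFDerivAt (fun x : ℝ × ℝ => eta k x.2)
      (deriv (eta k) x.2 • ContinuousLinearMap.snd ℝ ℝ ℝ) x :=
    (hd x.2).hasDerivAt.comp_hasFDerivAt x hasFDerivAt_snd
  have h3 : fderiv ℝ (chi k) x = _ := (h1.mul h2).fderiv
  rw [h3]
  simp

lemma div2_chi_smul (k : ℝ) {f : ℝ × ℝ → ℝ × ℝ} (hf : ContDiff ℝ (⊤ : ℕ∞) f) (x : ℝ × ℝ) :
    div2 (fun y => chi k y • f y) x = chi k x * div2 f x +
      (eta k x.2 * deriv (eta k) x.1 * (f x).1 + eta k x.1 * deriv (eta k) x.2 * (f x).2) := by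
  have hd : DifferentiableAt ℝ f x := (hf.differentiable (by simp)) x
  have hc : DifferentiableAt ℝ (chi k) x := ((chi_contDiff k).differentiable (by simp)) x
  have h1 : fderiv ℝ (fun y => chi k y • f y) x = _ := fderiv_fun_smul hc hd
  simp only [div2, h1]
  simp [chi_deriv]
  ring

lemma kap_int2 (k : ℝ) : ∫ x in Oq, (kap k x.1 + kap k x.2) ≤ 8 := by
  have hi : IntegrableOn (kap k) (Set.Ioo (-1) 1) :=
    ((kap_cont k).integrableOn_Icc (a := -1) (b := 1)).mono_set Set.Ioo_subset_Icc_self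
  have h1 : ∫ x in Oq, kap k x.1 = (∫ s in Set.Ioo (-1 : ℝ) 1, kap k s) * 2 := by
    have := setIntegral_prod_mul (μ := (volume : Measure ℝ)) (ν := (volume : Measure ℝ)) (kap k)
      (fun _ : ℝ => (1 : ℝ)) (Set.Ioo (-1) 1) (Set.Ioo (-1) 1)
    simp only [mul_one] at this
    rw [Oq, Measure.volume_eq_prod, this]
    simp [Measure.real]
    left; norm_num
  have h2 : ∫ x in Oq, kap k x.2 = 2 * (∫ s in Set.Ioo (-1 : ℝ) 1, kap k s) := by
    have := setIntegral_prod_mul (μ := (volume : Measure ℝ)) (ν := (volume : Measure ℝ))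
      (fun _ : ℝ => (1 : ℝ)) (kap k) (Set.Ioo (-1) 1) (Set.Ioo (-1) 1)
    simp only [one_mul] at this
    rw [Oq, Measure.volume_eq_prod, this]
    simp [Measure.real]
    left; norm_num
  have hc : IsCompact Isq := by rw [Isq_eq]; exact isCompact_Icc.prod isCompact_Icc
  have c := kap_cont k
  have i1 : IntegrableOn (fun x : ℝ × ℝ => kap k x.1) Oq :=
    ((show Continuous fun x : ℝ × ℝ => kap k x.1 by fun_prop).continuousOn.integrableOn_compact
      hc).mono_set Oq_subset_Isq
  have i2 : IntegrableOn (fun x : ℝ × ℝ => kap k x.2) Oq :=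
    ((show Continuous fun x : ℝ × ℝ => kap k x.2 by fun_prop).continuousOn.integrableOn_compact
      hc).mono_set Oq_subset_Isq
  rw [integral_add i1 i2, h1, h2]
  linarith [kap_int k]

lemma finite_per {E : Set (ℝ × ℝ)} {P : ℝ} (hE : HP E P) (hm : MeasurableSet E)
    (hO : E ⊆ Oq) : per E ≠ ⊤ := by
  have hvt : volume E ≠ ⊤ := ((measure_mono hO).trans_lt (by rw [volume_Oq]; norm_num)).ne
  have hc : IsCompact Isq := by rw [Isq_eq]; exact isCompact_Icc.prod isCompact_Icc
  suffices h : per E ≤ ENNReal.ofReal (P + 8) from (h.trans_lt ENNReal.ofReal_lt_top).ne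
  refine iSup₂_le fun f hf => ENNReal.ofReal_le_ofReal ?_
  obtain ⟨hfs, hfc, hf1⟩ := hf
  have hn : ∀ x, |(f x).1| ≤ 1 ∧ |(f x).2| ≤ 1 := by
    intro x
    have := hf1 x
    rw [eNorm2, Real.sqrt_le_one] at this
    constructor <;> rw [← sq_le_one_iff_abs_le_one] <;> nlinarith [sq_nonneg (f x).1, sq_nonneg (f x).2]
  have hint := div2_integrable hfs hfc
  have key : ∀ k : ℝ, 0 < k → ∫ x in E, chi k x * div2 f x ≤ P + 8 := by
    intro k hk0
    obtain ⟨g, hg⟩ : ∃ g : ℝ × ℝ → ℝ × ℝ, g = fun y => chi k y • f y := ⟨_, rfl⟩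
    have hgs : ContDiff ℝ (⊤ : ℕ∞) g := by
      rw [hg]; exact (chi_contDiff k).smul hfs
    have hgt : tsupport g ⊆ Oq := by
      have : tsupport g ⊆ Set.Icc (-(1 - 1 / k)) (1 - 1 / k) ×ˢ Set.Icc (-(1 - 1 / k)) (1 - 1 / k) := by
        refine closure_minimal ?_ (isClosed_Icc.prod isClosed_Icc)
        intro x hx
        have hx' : chi k x ≠ 0 := fun h => hx (by simp [hg, h])
        exact ⟨eta_supp hk0 (left_ne_zero_of_mul hx'), eta_supp hk0 (right_ne_zero_of_mul hx')⟩
      have hpos : 0 < 1 / k := by positivity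
      refine this.trans (Set.prod_mono ?_ ?_) <;>
      · intro s hs
        constructor <;> linarith [hs.1, hs.2]
    have hgc : HasCompactSupport g := by
      refine hfc.mono fun x hx hfx => hx ?_
      rw [hg]
      change chi k x • f x = 0
      rw [hfx, smul_zero]
    have h1 := hE 1 g zero_le_one hgs hgc hgt (by
      intro x
      rw [hg]
      change ‖chi k x • f x‖ ≤ 1
      rw [norm_smul, Real.norm_of_nonneg (chi_mem k x).1]
      have : ‖f x‖ ≤ 1 := max_le (hn x).1 (hn x).2
      exact mul_le_one₀ (chi_mem k x).2 (norm_nonneg _) this)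
    have cont := kap_cont k
    have i1 : IntegrableOn (fun x : ℝ × ℝ => kap k x.1 + kap k x.2) Oq :=
      ((show Continuous fun x : ℝ × ℝ => kap k x.1 + kap k x.2 by
        fun_prop).continuousOn.integrableOn_compact hc).mono_set Oq_subset_Isq
    have hgi := div2_integrable hgs hgc
    have hle : ∫ x in E, chi k x * div2 f x ≤ ∫ x in E, (div2 g x + (kap k x.1 + kap k x.2)) := by
      refine setIntegral_mono_on ?_ (hgi.integrableOn.add (i1.mono_set hO)) hm ?_
      · refine Integrable.integrableOn ?_
        refine hint.mono ((chi_contDiff k).continuous.mul (div2_cont hfs)).aestronglyMeasurable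
          (Filter.Eventually.of_forall fun x => ?_)
        rw [norm_mul, Real.norm_of_nonneg (chi_mem k x).1]
        exact mul_le_of_le_one_left (norm_nonneg _) (chi_mem k x).2
      · intro x _
        rw [hg, div2_chi_smul k hfs]
        have gen : ∀ e d φ κ : ℝ, e ∈ Set.Icc (0 : ℝ) 1 → |d| ≤ κ → |φ| ≤ 1 → -κ ≤ e * d * φ := by
          intro e d φ κ he hd hφ
          have : |e * d * φ| ≤ κ := by
            rw [abs_mul, abs_mul, abs_of_nonneg he.1]
            have a := abs_nonneg d
            calc e * |d| * |φ| ≤ 1 * |d| * 1 := by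
                  gcongr
                  exact he.2
              _ ≤ κ := by linarith
          exact (abs_le.1 this).1
        have g1 := gen _ _ _ _ (eta_mem k x.2) (eta_deriv_le hk0 x.1) (hn x).1
        have g2 := gen _ _ _ _ (eta_mem k x.1) (eta_deriv_le hk0 x.2) (hn x).2
        linarith
    rw [integral_add hgi.integrableOn (i1.mono_set hO)] at hle
    have h3 : ∫ x in E, (kap k x.1 + kap k x.2) ≤ ∫ x in Oq, (kap k x.1 + kap k x.2) :=
      setIntegral_mono_set i1
        (Filter.Eventually.of_forall fun x => add_nonneg (kap_nonneg hk0 _) (kap_nonneg hk0 _))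
        (Filter.Eventually.of_forall hO)
    linarith [kap_int2 k]
  refine le_of_tendsto' (x := atTop) (f := fun n : ℕ => ∫ x in E, chi ((n : ℝ) + 1) x * div2 f x) ?_
    (fun n => key _ (by positivity))
  refine tendsto_integral_of_dominated_convergence (fun x => ‖div2 f x‖) ?_ hint.integrableOn.norm ?_ ?_
  · exact fun n => ((chi_contDiff _).continuous.mul (div2_cont hfs)).aestronglyMeasurable
  · refine fun n => Filter.Eventually.of_forall fun x => ?_
    rw [norm_mul, Real.norm_of_nonneg (chi_mem _ x).1]
    exact mul_le_of_le_one_left (norm_nonneg _) (chi_mem _ x).2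
  · refine (ae_restrict_iff' hm).2 (Filter.Eventually.of_forall fun x hx => ?_)
    refine tendsto_const_nhds.congr' ?_
    filter_upwards [eta_one (hO hx).1, eta_one (hO hx).2] with n h1 h2
    rw [chi, h1, h2]
    ring

lemma HP.mono {E : Set (ℝ × ℝ)} {P P' : ℝ} (h : HP E P) (hP : P ≤ P') : HP E P' :=
  fun B f hB h1 h2 h3 h4 => (h B f hB h1 h2 h3 h4).trans (mul_le_mul_of_nonneg_left hP hB)

lemma regularize {E : Set (ℝ × ℝ)} (hE : E ⊆ Isq) :
    ∃ F : Set (ℝ × ℝ), MeasurableSet F ∧ F ⊆ Oq ∧ volume.restrict F = volume.restrict E := by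
  have hIt : volume Isq < ⊤ := by
    rw [← measure_congr Oq_ae_eq, volume_Oq]; norm_num
  have hEt : volume E ≠ ⊤ := ((measure_mono hE).trans_lt hIt).ne
  have hOm : MeasurableSet Oq := isOpen_Oq.measurableSet
  refine ⟨Oq ∩ toMeasurable volume E, hOm.inter (measurableSet_toMeasurable _ _),
    inter_subset_left, ?_⟩
  rw [← Measure.restrict_restrict hOm, Measure.restrict_toMeasurable hEt,
    Measure.restrict_restrict hOm]
  refine Measure.restrict_congr_set ?_
  have : (Oq ∩ E : Set (ℝ × ℝ)) =ᵐ[volume] (Isq ∩ E : Set (ℝ × ℝ)) :=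
    Oq_ae_eq.inter (Filter.EventuallyEq.rfl)
  rwa [inter_eq_right.2 hE] at this

/-- Existence of optimizers: for every `a ∈ [1,3]`, the set `𝒞_τ^(a)` of optimizers of the
variational problem over sets of finite perimeter in the square is non-empty. -/
theorem exists_finite_perimeter_optimizer (τ : ℝ × ℝ → ℝ) (hτ : IsNorm2 τ)
    (a : ℝ) (ha : a ∈ Set.Icc (1 : ℝ) 3) :
    ∃ E : Set (ℝ × ℝ), MemC E ∧ volume E ≤ ENNReal.ofReal a ∧ conduct τ E = psi τ a := by
  by_cases hpsi : psi τ a = ⊤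
  · refine ⟨∅, ⟨Set.empty_subset _, ?_⟩, by simp, ?_⟩
    · simp [per]
    · rw [hpsi]; simp [conduct]
  obtain ⟨C, hC, hd⟩ := dual_bound τ hτ
  -- a minimizing sequence
  have hex : ∀ n : ℕ, ∃ E : Set (ℝ × ℝ), MeasurableSet E ∧ E ⊆ Oq ∧ volume E ≤ ENNReal.ofReal a ∧
      volume E ≠ 0 ∧ surfE τ E ≤ (psi τ a + ((n : ℝ≥0∞) + 1)⁻¹) * volume E := by
    intro n
    have hlt : psi τ a < psi τ a + ((n : ℝ≥0∞) + 1)⁻¹ :=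
      ENNReal.lt_add_right hpsi (by simp)
    conv_lhs at hlt => rw [psi]
    simp only [iInf_lt_iff] at hlt
    obtain ⟨E, ⟨hEC, hEa⟩, hcond⟩ := hlt
    obtain ⟨F, hFm, hFO, hFE⟩ := regularize hEC.1
    have hvol : volume F = volume E := by
      rw [← Measure.restrict_apply_univ F, hFE, Measure.restrict_apply_univ]
    have hsurf : surfE τ F = surfE τ E := by
      unfold surfE
      rw [hFE]
    have hv0 : volume E ≠ 0 := fun h => by
      rw [conduct, if_pos h] at hcond
      exact not_top_lt hcond
    have hvt : volume E ≠ ⊤ := (hEa.trans_lt ENNReal.ofReal_lt_top).ne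
    refine ⟨F, hFm, hFO, hvol ▸ hEa, hvol ▸ hv0, ?_⟩
    rw [hsurf, hvol]
    rw [conduct, if_neg hv0] at hcond
    exact (ENNReal.div_le_iff hv0 hvt).1 hcond.le
  choose E hm hO hva hv0 hs using hex
  have hvt : ∀ n, volume (E n) ≠ ⊤ := fun n => ((hva n).trans_lt ENNReal.ofReal_lt_top).ne
  set A : ℝ≥0∞ := psi τ a + 1 with hA
  have hAt : A ≠ ⊤ := ENNReal.add_ne_top.2 ⟨hpsi, by norm_num⟩
  have hs' : ∀ n, surfE τ (E n) ≤ A * volume (E n) := fun n => by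
    refine (hs n).trans ?_
    gcongr
    rw [hA]
    exact add_le_add le_rfl (ENNReal.inv_le_one.2 le_add_self)
  have hst : ∀ n, surfE τ (E n) ≠ ⊤ := fun n =>
    ((hs' n).trans_lt (ENNReal.mul_lt_top hAt.lt_top (hvt n).lt_top)).ne
  have hHP : ∀ n, HP (E n) (C * (A.toReal * (volume (E n)).toReal)) := fun n => by
    refine (HP_of_surfE τ hC hd (E n) (hst n)).mono ?_
    rw [← ENNReal.toReal_mul]
    gcongr
    · exact ENNReal.mul_ne_top hAt (hvt n)
    · exact hs' n
  have ha0 : (0 : ℝ) ≤ a := by linarith [ha.1]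
  have hHP' : ∀ n, HP (E n) (C * (A.toReal * a)) := fun n => by
    refine (hHP n).mono ?_
    gcongr
    exact ENNReal.toReal_le_of_le_ofReal ha0 (hva n)
  -- volumes are bounded below
  obtain ⟨δ, hδ0, hδ1, hδ⟩ : ∃ δ : ℝ, 0 < δ ∧ δ < 1 ∧ 8 * (δ * (C * A.toReal)) < 1 := by
    have hq : 0 ≤ C * A.toReal := by positivity
    refine ⟨min (1 / 2) (1 / (16 * (C * A.toReal + 1))), by positivity,
      (min_le_left _ _).trans_lt (by norm_num), ?_⟩
    have : min (1 / 2) (1 / (16 * (C * A.toReal + 1))) * (C * A.toReal) ≤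
        1 / (16 * (C * A.toReal + 1)) * (C * A.toReal + 1) :=
      mul_le_mul (min_le_right _ _) (by linarith) hq (by positivity)
    have h2 : 1 / (16 * (C * A.toReal + 1)) * (C * A.toReal + 1) = 1 / 16 := by field_simp
    linarith
  have hlow : ∀ n, ENNReal.ofReal δ * ENNReal.ofReal δ / 2 ≤ volume (E n) := by
    intro n
    by_contra hcon
    push Not at hcon
    have h1 := isop hδ0 hδ1 (hO n) (hHP n) (by positivity) (hm n) hcon.le
    have hvp : 0 < (volume (E n)).toReal := ENNReal.toReal_pos (hv0 n) (hvt n)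
    have h2 : (volume (E n)).toReal ≤ 8 * (δ * (C * (A.toReal * (volume (E n)).toReal))) := by
      have h3 : volume (E n) ≤
          ENNReal.ofReal (8 * (δ * (C * (A.toReal * (volume (E n)).toReal)))) := by
        rw [ENNReal.ofReal_mul (by norm_num), ENNReal.ofReal_ofNat]
        exact h1
      exact ENNReal.toReal_le_of_le_ofReal (by positivity) h3
    have h4 : 8 * (δ * (C * (A.toReal * (volume (E n)).toReal))) =
        8 * (δ * (C * A.toReal)) * (volume (E n)).toReal := by ring
    rw [h4] at h2
    nlinarith
  obtain ⟨φ, hφ, F, hFm, hFO, hconv⟩ := compactness E hm hO (by positivity) hHP'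
  have hFt : volume F ≠ ⊤ := ((measure_mono hFO).trans_lt (by rw [volume_Oq]; norm_num)).ne
  have hOm : MeasurableSet Oq := isOpen_Oq.measurableSet
  have hvol : Tendsto (fun n => volume (E (φ n))) atTop (nhds (volume F)) := by
    have h1 := hconv (Oq.indicator fun _ => 1)
      ((integrable_indicator_iff hOm).2 (integrableOn_const (by rw [volume_Oq]; norm_num)))
    have h2 : ∀ G : Set (ℝ × ℝ), G ⊆ Oq →
        ∫ x in G, Oq.indicator (fun _ => (1 : ℝ)) x = (volume G).toReal := by
      intro G hG
      rw [integral_indicator hOm, Measure.restrict_restrict hOm, inter_eq_right.2 hG]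
      simp [Measure.real]
    rw [h2 F hFO] at h1
    have h3 := ENNReal.tendsto_ofReal h1
    rw [ENNReal.ofReal_toReal hFt] at h3
    refine h3.congr fun n => ?_
    rw [h2 _ (hO _), ENNReal.ofReal_toReal (hvt _)]
  have hFa : volume F ≤ ENNReal.ofReal a := le_of_tendsto' hvol fun n => hva _
  have hF0 : volume F ≠ 0 := by
    have h1 : ENNReal.ofReal δ * ENNReal.ofReal δ / 2 ≤ volume F :=
      ge_of_tendsto' hvol fun n => hlow _
    have h2 : 0 < ENNReal.ofReal δ * ENNReal.ofReal δ / 2 := by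
      apply ENNReal.half_pos
      simp [hδ0]
    exact (h2.trans_le h1).ne'
  have hbd : Tendsto (fun n => (psi τ a + ((φ n : ℝ≥0∞) + 1)⁻¹) * volume (E (φ n))) atTop
      (nhds (psi τ a * volume F)) := by
    have h1 : Tendsto (fun n : ℕ => ((n : ℝ≥0∞) + 1)⁻¹) atTop (nhds 0) := by
      have := (tendsto_add_atTop_iff_nat 1).2 ENNReal.tendsto_inv_nat_nhds_zero
      simpa using this
    have h2 : Tendsto (fun n => psi τ a + ((φ n : ℝ≥0∞) + 1)⁻¹) atTop (nhds (psi τ a)) := by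
      simpa using (tendsto_const_nhds (x := psi τ a)).add (h1.comp hφ.tendsto_atTop)
    exact ENNReal.Tendsto.mul h2 (Or.inr hFt) hvol (Or.inr hpsi)
  have hsF : surfE τ F ≤ psi τ a * volume F := by
    refine iSup₂_le fun f hf => ?_
    have h1 := ENNReal.tendsto_ofReal (hconv (div2 f) (div2_integrable hf.1 hf.2.1))
    refine le_of_tendsto_of_tendsto' h1 hbd fun n => ?_
    refine le_trans ?_ (hs (φ n))
    unfold surfE
    exact le_iSup₂ (f := fun f _ => ENNReal.ofReal (∫ x in E (φ n), div2 f x)) f hf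
  have hsFt : surfE τ F ≠ ⊤ :=
    (hsF.trans_lt (ENNReal.mul_lt_top (lt_top_iff_ne_top.2 hpsi) hFt.lt_top)).ne
  have hmem : MemC F := ⟨hFO.trans Oq_subset_Isq,
    finite_per (HP_of_surfE τ hC hd F hsFt) hFm hFO⟩
  refine ⟨F, hmem, hFa, le_antisymm ?_ ?_⟩
  · rw [conduct, if_neg hF0]
    exact (ENNReal.div_le_iff hF0 hFt).2 hsF
  · exact iInf₂_le (f := fun E _ => conduct τ E) F ⟨hmem, hFa⟩
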